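/- (Stopping criterion with heterogeneous lower-layer errors.) Assume 0 < γ, γ · α⁺ < 1, α⁺_k > 0 for every k ∈ K, and set λ = (γ · α⁺)/(1 − γ · α⁺). Suppose ‖W a − W* a‖ ≤ ε (κ a) for all a ∈ A, V* is a fixed point of B*, V^{i} = B V^{i−1} for given V^{i−1}, V^{i} : S → ℝ, and ‖V^{i} − V*‖ ≤ λ · ‖V^{i} − V^{i−1}‖. If ‖V^{i} − V^{i−1}‖ ≤ min over k ∈ K of ( (1/λ) · ( ε_r/(γ · α⁺_k) − ((1 − α⁻_k)/α⁺_k) · ε k ) ), then ‖B V^{i} − V*‖ ≤ ε_r. -/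

import Mathlib

theorem sup'_le_sup'_add {ι : Type*} {s : Finset ι} (hs : s.Nonempty) {f g : ι → ℝ} {c : ℝ}
    (h : ∀ i ∈ s, |f i - g i| ≤ c) : s.sup' hs f ≤ s.sup' hs g + c :=
  Finset.sup'_le hs f fun i hi => by
    have hg := Finset.le_sup' g hi
    have hfg := (abs_le.mp (h i hi)).2
    linarith

theorem abs_sup'_sub_sup'_le {ι : Type*} {s : Finset ι} (hs : s.Nonempty) {f g : ι → ℝ} {c : ℝ}
    (h : ∀ i ∈ s, |f i - g i| ≤ c) : |s.sup' hs f - s.sup' hs g| ≤ c := by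
  have hfg := sup'_le_sup'_add hs h
  have hgf := sup'_le_sup'_add hs (f := g) (g := f) fun i hi => abs_sub_comm (f i) (g i) ▸ h i hi
  exact abs_le.mpr ⟨by linarith, by linarith⟩

theorem abs_sum_mixture_le {S : Type*} [Fintype S] {p q u v : S → ℝ} {t c d : ℝ}
    (ht0 : 0 ≤ t) (ht1 : t ≤ 1) (hp : ∀ x, 0 ≤ p x) (hp1 : ∑ x, p x = 1)
    (hq : ∀ x, 0 ≤ q x) (hq1 : ∑ x, q x = 1) (hu : ∀ x, |u x| ≤ c) (hv : ∀ x, |v x| ≤ d) :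
    |∑ x, (t * p x * u x + (1 - t) * q x * v x)| ≤ t * c + (1 - t) * d := by
  have ht1' : 0 ≤ 1 - t := by linarith
  calc |∑ x, (t * p x * u x + (1 - t) * q x * v x)|
      ≤ ∑ x, |t * p x * u x + (1 - t) * q x * v x| := Finset.abs_sum_le_sum_abs _ _
    _ ≤ ∑ x, (p x * (t * c) + q x * ((1 - t) * d)) := by
        refine Finset.sum_le_sum fun x _ => (abs_add_le _ _).trans ?_
        have hpt := mul_nonneg ht0 (hp x)
        have hqt := mul_nonneg ht1' (hq x)
        rw [abs_mul (t * p x), abs_mul ((1 - t) * q x), abs_of_nonneg hpt, abs_of_nonneg hqt]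
        linarith [mul_le_mul_of_nonneg_left (hu x) hpt, mul_le_mul_of_nonneg_left (hv x) hqt]
    _ = t * c + (1 - t) * d := by
        rw [Finset.sum_add_distrib, ← Finset.sum_mul, ← Finset.sum_mul, hp1, hq1, one_mul, one_mul]


theorem stmt6
    {S A : Type} [Fintype S] [Nonempty S] [Fintype A] [Nonempty A]
    (α : S → A → ℝ) (T F : S → A → S → ℝ) (R : S → A → ℝ) (γ : ℝ)
    (W : A → S → ℝ)
    (hα : ∀ s a, 0 ≤ α s a ∧ α s a ≤ 1)
    (hT : ∀ s a s', 0 ≤ T s a s') (hTsum : ∀ s a, ∑ s', T s a s' = 1)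
    (hF : ∀ s a s', 0 ≤ F s a s') (hFsum : ∀ s a, ∑ s', F s a s' = 1)
    (hγ : 0 ≤ γ ∧ γ ≤ 1)
    (B : (S → ℝ) → (S → ℝ))
    (hB : ∀ V s, B V s =
      Finset.univ.sup' Finset.univ_nonempty (fun a : A =>
        R s a + γ * ∑ s', (α s a * T s a s' * V s' +
          (1 - α s a) * F s a s' * W a s')))
    (norm' : (S → ℝ) → ℝ)
    (hnorm : ∀ V, norm' V = Finset.univ.sup' Finset.univ_nonempty (fun s : S => |V s|))
    (aplus : ℝ)
    (haplus : aplus = Finset.univ.sup' Finset.univ_nonempty (fun p : S × A => α p.1 p.2))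
    {K : Type} [Fintype K] [Nonempty K] [DecidableEq K]
    (κ : A → K) (hκ : Function.Surjective κ)
    (hKne : ∀ k : K, (Finset.univ.filter (fun p : S × A => κ p.2 = k)).Nonempty)
    (aplusk ainfk : K → ℝ)
    (haplusk : ∀ k, aplusk k =
      (Finset.univ.filter (fun p : S × A => κ p.2 = k)).sup' (hKne k) (fun p => α p.1 p.2))
    (hainfk : ∀ k, ainfk k =
      (Finset.univ.filter (fun p : S × A => κ p.2 = k)).inf' (hKne k) (fun p => α p.1 p.2))
    (Wstar : A → S → ℝ)
    (Bstar : (S → ℝ) → (S → ℝ))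
    (hBstar : ∀ V s, Bstar V s =
      Finset.univ.sup' Finset.univ_nonempty (fun a : A =>
        R s a + γ * ∑ s', (α s a * T s a s' * V s' +
          (1 - α s a) * F s a s' * Wstar a s')))
    (ε : K → ℝ) (εr : ℝ)
    (hγpos : 0 < γ) (hlt : γ * aplus < 1)
    (hapluskpos : ∀ k : K, 0 < aplusk k)
    (lam : ℝ) (hlam : lam = γ * aplus / (1 - γ * aplus))
    (herr : ∀ a : A, norm' (fun s => W a s - Wstar a s) ≤ ε (κ a))
    (Vstar : S → ℝ) (hfix : Bstar Vstar = Vstar)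
    (Viprev Vi : S → ℝ) (hstep : Vi = B Viprev)
    (hbound : norm' (fun s => Vi s - Vstar s) ≤ lam * norm' (fun s => Vi s - Viprev s))
    (hsmall : norm' (fun s => Vi s - Viprev s) ≤
      Finset.univ.inf' Finset.univ_nonempty (fun k : K =>
        (1 / lam) * (εr / (γ * aplusk k) - ((1 - ainfk k) / aplusk k) * ε k)))
    : norm' (fun s => B Vi s - Vstar s) ≤ εr := by
  have abs_le_norm : ∀ V s, |V s| ≤ norm' V := fun V s => by
    rw [hnorm]
    exact Finset.le_sup' (fun s => |V s|) (Finset.mem_univ s)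
  have hmem : ∀ s a, (s, a) ∈ Finset.univ.filter (fun p : S × A => κ p.2 = κ a) := fun s a => by
    simp
  have haplus_pos : 0 < aplus := by
    obtain ⟨k⟩ := ‹Nonempty K›
    refine (hapluskpos k).trans_le ?_
    rw [haplusk, haplus]
    exact Finset.sup'_mono _ (Finset.filter_subset _ _) (hKne k)
  have hlam_pos : 0 < lam := by
    rw [hlam]
    exact div_pos (mul_pos hγpos haplus_pos) (by linarith)
  rw [hnorm]
  refine Finset.sup'_le _ _ fun s _ => ?_
  rw [← congrFun hfix s, hB, hBstar]
  refine abs_sup'_sub_sup'_le _ fun a _ => ?_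
  have hmix := abs_sum_mixture_le (hα s a).1 (hα s a).2 (hT s a) (hTsum s a) (hF s a) (hFsum s a)
    (abs_le_norm fun x => Vi x - Vstar x)
    (fun x => (abs_le_norm (fun y => W a y - Wstar a y) x).trans (herr a))
  have hε : 0 ≤ ε (κ a) :=
    ((abs_nonneg _).trans (abs_le_norm (fun y => W a y - Wstar a y) s)).trans (herr a)
  have hd : 0 ≤ norm' fun x => Vi x - Vstar x :=
    (abs_nonneg _).trans (abs_le_norm (fun x => Vi x - Vstar x) s)
  have hα_le : α s a ≤ aplusk (κ a) := by
    rw [haplusk]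
    exact Finset.le_sup' (fun p : S × A => α p.1 p.2) (hmem s a)
  have hle_α : ainfk (κ a) ≤ α s a := by
    rw [hainfk]
    exact Finset.inf'_le (fun p : S × A => α p.1 p.2) (hmem s a)
  have hk := hapluskpos (κ a)
  have hthreshold : norm' (fun x => Vi x - Vstar x) ≤
      εr / (γ * aplusk (κ a)) - (1 - ainfk (κ a)) / aplusk (κ a) * ε (κ a) := by
    refine hbound.trans ?_
    have h := hsmall.trans (Finset.inf'_le _ (Finset.mem_univ (κ a)))
    rwa [one_div_mul_eq_div, le_div_iff₀' hlam_pos] at h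
  have hdiff : R s a + γ * ∑ s', (α s a * T s a s' * Vi s' + (1 - α s a) * F s a s' * W a s') -
      (R s a + γ * ∑ s', (α s a * T s a s' * Vstar s' + (1 - α s a) * F s a s' * Wstar a s')) =
      γ * ∑ s', (α s a * T s a s' * (Vi s' - Vstar s') +
        (1 - α s a) * F s a s' * (W a s' - Wstar a s')) := by
    rw [add_sub_add_left_eq_sub, ← mul_sub, ← Finset.sum_sub_distrib]
    congr 1
    exact Finset.sum_congr rfl fun _ _ => by ring
  rw [hdiff, abs_mul, abs_of_pos hγpos]
  calc γ * |∑ s', (α s a * T s a s' * (Vi s' - Vstar s') +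
        (1 - α s a) * F s a s' * (W a s' - Wstar a s'))|
      ≤ γ * (aplusk (κ a) * norm' (fun x => Vi x - Vstar x) + (1 - ainfk (κ a)) * ε (κ a)) := by
        refine mul_le_mul_of_nonneg_left (hmix.trans ?_) hγpos.le
        gcongr
    _ ≤ γ * (aplusk (κ a) * (εr / (γ * aplusk (κ a)) -
          (1 - ainfk (κ a)) / aplusk (κ a) * ε (κ a)) + (1 - ainfk (κ a)) * ε (κ a)) := by
        gcongr
    _ = εr := by
        field_simp
        ring
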